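/- For every integer k ≥ 1, let G be the graph obtained by glueing k disjoint copies of the graph G₄ together at their distinguished nodes v₀, with the inherited costs c. Then G has 3k + 1 nodes and the circuit diameter of P(G,c) is at least 4k; that is, there exist two extreme points of P(G,c) such that every circuit walk from one to the other has length at least 4k. -/

import Mathlib

open scoped BigOperators

section DualNetworkFlow

variable {V : Type*}

/-- Adjacency in the underlying undirected graph of the directed edge set `E`. -/
def UAdj (E : Set (V × V)) (a b : V) : Prop := (a, b) ∈ E ∨ (b, a) ∈ E

/-- The underlying undirected graph of `E` is connected. -/
def UConnected (E : Set (V × V)) : Prop :=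
  ∀ a b : V, Relation.ReflTransGen (UAdj E) a b

/-- A node set `S` is connected in the underlying undirected graph of `E`:
any two of its nodes are joined by a path inside `S`. -/
def SetConnected (E : Set (V × V)) (S : Set V) : Prop :=
  ∀ a ∈ S, ∀ b ∈ S, Relation.ReflTransGen (fun x y => x ∈ S ∧ y ∈ S ∧ UAdj E x y) a b

/-- The dual network flow polyhedron
`P(G,c) = { u : V → ℝ | u v₀ = 0, -u a + u b ≤ c (a,b) for all (a,b) ∈ E }`. -/
def dualPoly (E : Set (V × V)) (v₀ : V) (c : V × V → ℝ) : Set (V → ℝ) :=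
  {u | u v₀ = 0 ∧ ∀ e ∈ E, -u e.1 + u e.2 ≤ c e}

/-- An edge walk in the polyhedron `P`: a sequence of extreme points in which each pair of
consecutive points is distinct and spans a segment that is an extreme subset of `P`. -/
def IsEdgeWalk (P : Set (V → ℝ)) {k : ℕ} (w : Fin (k + 1) → V → ℝ) : Prop :=
  (∀ i, w i ∈ P.extremePoints ℝ) ∧
  ∀ i : Fin k, w i.castSucc ≠ w i.succ ∧ IsExtreme ℝ P (segment ℝ (w i.castSucc) (w i.succ))

/-- A circuit of a dual network flow polyhedron: `±` the indicator vector of a set `S` such that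
both `S` and its complement are nonempty and connected in the underlying undirected graph. -/
def IsCircuit (E : Set (V × V)) (g : V → ℝ) : Prop :=
  ∃ S : Set V, S.Nonempty ∧ Sᶜ.Nonempty ∧ SetConnected E S ∧ SetConnected E Sᶜ ∧
    (g = S.indicator 1 ∨ g = -S.indicator 1)

/-- A circuit walk in `P`: each step moves along a circuit direction by a maximal step length. -/
def IsCircuitWalk (E : Set (V × V)) (P : Set (V → ℝ)) {k : ℕ}
    (w : Fin (k + 1) → V → ℝ) : Prop :=
  (∀ i, w i ∈ P) ∧
  ∀ i : Fin k, ∃ (g : V → ℝ) (α : ℝ), IsCircuit E g ∧ 0 < α ∧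
    w i.succ = w i.castSucc + α • g ∧ ∀ β : ℝ, α < β → w i.castSucc + β • g ∉ P

/-- The combinatorial distance between two points: minimum length of an edge walk joining them. -/
noncomputable def combDist (P : Set (V → ℝ)) (u v : V → ℝ) : ℕ :=
  sInf {n | ∃ w : Fin (n + 1) → V → ℝ, IsEdgeWalk P w ∧ w 0 = u ∧ w (Fin.last n) = v}

/-- The combinatorial diameter of `P`: maximum combinatorial distance between extreme points. -/
noncomputable def combDiam (P : Set (V → ℝ)) : ℕ :=
  sSup {d | ∃ u ∈ P.extremePoints ℝ, ∃ v ∈ P.extremePoints ℝ, d = combDist P u v}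

/-- The circuit distance between two points: minimum length of a circuit walk joining them. -/
noncomputable def circuitDist (E : Set (V × V)) (P : Set (V → ℝ)) (u v : V → ℝ) : ℕ :=
  sInf {n | ∃ w : Fin (n + 1) → V → ℝ, IsCircuitWalk E P w ∧ w 0 = u ∧ w (Fin.last n) = v}

/-- The circuit diameter of `P`: maximum circuit distance between extreme points. -/
noncomputable def circuitDiam (E : Set (V × V)) (P : Set (V → ℝ)) : ℕ :=
  sSup {d | ∃ u ∈ P.extremePoints ℝ, ∃ v ∈ P.extremePoints ℝ, d = circuitDist E P u v}

end DualNetworkFlow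

section Glueing

variable {k : ℕ}

/-- Node set of the graph obtained by glueing the graphs on node sets `Vf i` together at the
distinguished nodes `v₀ i`; the glued node `v₀` is `none`. -/
abbrev GluedV (Vf : Fin k → Type*) (v₀ : ∀ i, Vf i) : Type _ :=
  Option (Σ i : Fin k, {x : Vf i // x ≠ v₀ i})

/-- The canonical map from the node set of component `i` into the glued node set,
sending `v₀ i` to the glued node `none`. -/
def glueMap {Vf : Fin k → Type*} [∀ i, DecidableEq (Vf i)] (v₀ : ∀ i, Vf i) (i : Fin k)
    (x : Vf i) : GluedV Vf v₀ :=
  if h : x = v₀ i then none else some ⟨i, ⟨x, h⟩⟩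

/-- Edge set of the glued graph: the disjoint union of the edge sets `Ef i`, with every
occurrence of `v₀ i` replaced by the glued node. -/
def GluedE {Vf : Fin k → Type*} [∀ i, DecidableEq (Vf i)] (Ef : ∀ i, Set (Vf i × Vf i))
    (v₀ : ∀ i, Vf i) : Set (GluedV Vf v₀ × GluedV Vf v₀) :=
  ⋃ i, (fun e : Vf i × Vf i => (glueMap v₀ i e.1, glueMap v₀ i e.2)) '' (Ef i)

end Glueing

/-- The edge set of the graph `G₄` of Example 1, on nodes `v₀ = 0, v₁ = 1, v₂ = 2, v₃ = 3`. -/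
def exampleE : Set (Fin 4 × Fin 4) :=
  {(3, 0), (2, 0), (3, 1), (0, 3), (0, 2), (1, 3), (0, 1), (1, 2), (2, 3)}

/-- The costs of the graph `G₄` of Example 1. -/
noncomputable def exampleC : Fin 4 × Fin 4 → ℝ := fun p =>
  if p = (3, 0) then 0 else if p = (2, 0) then 0 else if p = (3, 1) then 0
  else if p = (0, 3) then 2 else if p = (0, 2) then 4 / 3 else if p = (1, 3) then 4 / 3
  else if p = (0, 1) then 1 else if p = (1, 2) then 1 else if p = (2, 3) then 10 / 9 else 0

open Relation

section ExtremePoints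

variable {V : Type*} {E : Set (V × V)} {v₀ : V} {c : V × V → ℝ}

/-- A point of the dual network flow polyhedron whose tight edges connect every node to the
distinguished node is an extreme point. -/
theorem mem_extremePoints_dualPoly_of_tight {p : V → ℝ} (hp : p ∈ dualPoly E v₀ c)
    (hconn : ∀ a, ReflTransGen (UAdj {e | e ∈ E ∧ -p e.1 + p e.2 = c e}) v₀ a) :
    p ∈ (dualPoly E v₀ c).extremePoints ℝ := by
  refine ⟨hp, fun x hx y hy hxy => ?_⟩
  obtain ⟨s, t, hs, ht, hst, rfl⟩ := hxy
  have key : ∀ e ∈ E, -(s • x + t • y) e.1 + (s • x + t • y) e.2 = c e →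
      -x e.1 + x e.2 = c e := by
    intro e he h
    have h₁ := hx.2 e he
    have h₂ := hy.2 e he
    simp only [Pi.add_apply, Pi.smul_apply, smul_eq_mul] at h
    obtain rfl : t = 1 - s := by linarith
    nlinarith [mul_nonneg ht.le (sub_nonneg.2 h₂), mul_nonneg hs.le (sub_nonneg.2 h₁)]
  funext a
  induction hconn a with
  | refl => rw [hx.1, hp.1]
  | tail _ hbc ih =>
    rcases hbc with ⟨he, h⟩ | ⟨he, h⟩
    · have := key _ he h
      simp only at this h
      linarith
    · have := key _ he h
      simp only at this h
      linarith

end ExtremePoints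

section ScaledExample

/-- The edges of `G₄` as a list. -/
def exampleEdges : List (Fin 4 × Fin 4) :=
  [(3, 0), (2, 0), (3, 1), (0, 3), (0, 2), (1, 3), (0, 1), (1, 2), (2, 3)]

/-- The costs of `G₄` multiplied by `9`. -/
def scaledCost (e : Fin 4 × Fin 4) : ℤ :=
  ![![0, 9, 12, 18], ![0, 0, 9, 12], ![0, 0, 0, 10], ![0, 0, 0, 0]] e.1 e.2

/-- The vectors `±𝟙_S` for `S` a set of nodes of `G₄` avoiding `v₀`. -/
def exampleDirections : List (Fin 4 → ℤ) :=
  [1, -1].flatMap fun s => [0, s].flatMap fun a => [0, s].flatMap fun b =>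
    [0, s].map fun d => ![0, a, b, d]

/-- The slack of an edge of `G₄` at an integer point, after scaling by `9`. -/
def scaledSlack (q : Fin 4 → ℤ) (e : Fin 4 × Fin 4) : ℤ := scaledCost e + q e.1 - q e.2

/-- The points reached from `q` by moving along a circuit direction until an edge becomes tight,
in the polyhedron of `G₄` scaled by `9`. -/
def circuitSuccessors (q : Fin 4 → ℤ) : List (Fin 4 → ℤ) :=
  exampleDirections.flatMap fun g =>
    ((exampleEdges.filter fun e => g e.2 - g e.1 = 1).map fun e =>
      fun x => q x + scaledSlack q e * g x).filter fun r =>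
        exampleEdges.all fun e => 0 ≤ scaledSlack r e

/-- The points reached from the origin by `n` circuit steps in the scaled polyhedron of `G₄`. -/
def circuitReach : ℕ → List (Fin 4 → ℤ)
  | 0 => [0]
  | n + 1 => (circuitReach n).flatMap circuitSuccessors

theorem target_notMem_circuitReach : ∀ n < 4, ![0, 6, 12, 18] ∉ circuitReach n := by
  decide +kernel

theorem mem_exampleE_iff (e : Fin 4 × Fin 4) : e ∈ exampleE ↔ e ∈ exampleEdges := by
  simp [exampleE, exampleEdges]

theorem nine_mul_exampleC {e : Fin 4 × Fin 4} (he : e ∈ exampleE) :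
    9 * exampleC e = scaledCost e := by
  simp only [exampleE, Set.mem_insert_iff, Set.mem_singleton_iff] at he
  rcases he with rfl | rfl | rfl | rfl | rfl | rfl | rfl | rfl | rfl <;>
    simp [exampleC, scaledCost] <;> norm_num

end ScaledExample

section Copies

variable {k : ℕ}

/-- The node set of `k` glued copies of `G₄`. -/
abbrev CopiesV (k : ℕ) : Type := GluedV (fun _ : Fin k => Fin 4) (fun _ => 0)

/-- The edge set of `k` glued copies of `G₄`. -/
abbrev CopiesE (k : ℕ) : Set (CopiesV k × CopiesV k) :=
  GluedE (fun _ : Fin k => exampleE) (fun _ => 0)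

/-- The node of the `i`-th copy corresponding to the node `x` of `G₄`. -/
abbrev copyNode (i : Fin k) (x : Fin 4) : CopiesV k :=
  glueMap (fun _ : Fin k => (0 : Fin 4)) i x

theorem copyNode_zero (i : Fin k) : copyNode i 0 = none := by
  simp [copyNode, glueMap]

theorem copyNode_of_ne (i : Fin k) {x : Fin 4} (hx : x ≠ 0) :
    copyNode i x = some ⟨i, ⟨x, hx⟩⟩ := by
  simp [copyNode, glueMap, hx]

theorem mem_copiesE_iff (e : CopiesV k × CopiesV k) :
    e ∈ CopiesE k ↔ ∃ i, ∃ f ∈ exampleE, (copyNode i f.1, copyNode i f.2) = e := by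
  simp only [CopiesE, GluedE, Set.mem_iUnion, Set.mem_image]

/-- Adjacent nodes different from the glued node belong to the same copy. -/
theorem copy_eq_of_uAdj {a b : Σ _ : Fin k, {x : Fin 4 // x ≠ 0}}
    (h : UAdj (CopiesE k) (some a) (some b)) : a.1 = b.1 := by
  have aux : ∀ {i : Fin k} {x : Fin 4} {a : Σ _ : Fin k, {x : Fin 4 // x ≠ 0}},
      copyNode i x = some a → a.1 = i := by
    intro i x a hx
    by_cases h0 : x = 0
    · subst h0
      simp [copyNode_zero] at hx
    · rw [copyNode_of_ne i h0, Option.some.injEq] at hx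
      rw [← hx]
  rcases h with h | h <;> rw [mem_copiesE_iff] at h <;>
    obtain ⟨i, f, -, hf⟩ := h <;> rw [Prod.mk.injEq] at hf
  · rw [aux hf.1, aux hf.2]
  · rw [aux hf.1, aux hf.2]

/-- A connected node set avoiding the glued node lies in a single copy. -/
theorem exists_copy_of_setConnected {S : Set (CopiesV k)} (hne : S.Nonempty)
    (hS : SetConnected (CopiesE k) S) (h0 : none ∉ S) :
    ∃ i, ∀ j, j ≠ i → ∀ x, copyNode j x ∉ S := by
  obtain ⟨_ | a, ha⟩ := hne
  · exact absurd ha h0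
  have same : ∀ b, ReflTransGen (fun x y => x ∈ S ∧ y ∈ S ∧ UAdj (CopiesE k) x y) (some a) b →
      ∃ b', b = some b' ∧ b'.1 = a.1 := by
    intro b hb
    induction hb with
    | refl => exact ⟨a, rfl, rfl⟩
    | @tail b d _ hbd ih =>
      obtain ⟨b', rfl, hb'⟩ := ih
      obtain ⟨-, hd, hadj⟩ := hbd
      cases d with
      | none => exact absurd hd h0
      | some d' => exact ⟨d', rfl, (copy_eq_of_uAdj hadj).symm.trans hb'⟩
  refine ⟨a.1, fun j hj x hx => hj ?_⟩
  obtain ⟨b', hb, hb'⟩ := same _ (hS _ ha _ hx)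
  have hx0 : x ≠ 0 := by
    rintro rfl
    rw [copyNode_zero] at hb
    simp at hb
  rw [copyNode_of_ne j hx0, Option.some.injEq] at hb
  rw [← hb', ← hb]

/-- A circuit vanishing at the glued node is supported on one copy, where it restricts to one
of the directions of `G₄`. -/
theorem exists_copy_of_isCircuit {g : CopiesV k → ℝ} (hg : IsCircuit (CopiesE k) g)
    (h0 : g none = 0) :
    ∃ i, (∀ j, j ≠ i → ∀ x, g (copyNode j x) = 0) ∧
      ∃ d ∈ exampleDirections, ∀ x, g (copyNode i x) = d x := by
  classical
  obtain ⟨S, hne, -, hS, -, hgS⟩ := hg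
  have hnone : none ∉ S := by
    intro hmem
    rcases hgS with rfl | rfl <;> simp [hmem] at h0
  obtain ⟨i, hi⟩ := exists_copy_of_setConnected hne hS hnone
  have hsign : ∃ s ∈ ([1, -1] : List ℤ), ∀ a, g a = if a ∈ S then (s : ℝ) else 0 := by
    rcases hgS with rfl | rfl
    · exact ⟨1, by simp, fun a => by simp [Set.indicator_apply]⟩
    · exact ⟨-1, by simp, fun a => by by_cases ha : a ∈ S <;> simp [ha]⟩
  obtain ⟨s, hs, hgs⟩ := hsign
  refine ⟨i, fun j hj x => by rw [hgs, if_neg (hi j hj x)], ?_⟩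
  let d : Fin 4 → ℤ := fun x => if copyNode i x ∈ S then s else 0
  have hd : ∀ x, d x ∈ [0, s] := fun x => by
    by_cases hx : copyNode i x ∈ S <;> simp [d, hx]
  refine ⟨![0, d 1, d 2, d 3], ?_, ?_⟩
  · simp only [exampleDirections, List.mem_flatMap, List.mem_map]
    exact ⟨s, hs, d 1, hd 1, d 2, hd 2, d 3, hd 3, rfl⟩
  · intro x
    have hx : ![0, d 1, d 2, d 3] x = d x := by
      fin_cases x <;> simp [d, copyNode_zero, hnone]
    rw [hx, hgs]
    by_cases h : copyNode i x ∈ S <;> simp [d, h]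

variable {c : CopiesV k × CopiesV k → ℝ}

theorem mem_dualPoly_copies_iff
    (hc : ∀ (i : Fin k), ∀ e ∈ exampleE, c (copyNode i e.1, copyNode i e.2) = exampleC e)
    (u : CopiesV k → ℝ) :
    u ∈ dualPoly (CopiesE k) none c ↔ u none = 0 ∧
      ∀ i, ∀ e ∈ exampleE, -u (copyNode i e.1) + u (copyNode i e.2) ≤ exampleC e := by
  refine and_congr_right fun _ => ⟨fun h i e he => ?_, fun h e he => ?_⟩
  · rw [← hc i e he]
    exact h _ ((mem_copiesE_iff _).2 ⟨i, e, he, rfl⟩)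
  · obtain ⟨i, f, hf, rfl⟩ := (mem_copiesE_iff _).1 he
    rw [hc i f hf]
    exact h i f hf

/-- A maximal circuit step changes only one copy, and there it is a step of the scaled
polyhedron of `G₄`. -/
theorem exists_copy_of_circuit_step
    (hc : ∀ (i : Fin k), ∀ e ∈ exampleE, c (copyNode i e.1, copyNode i e.2) = exampleC e)
    {p g : CopiesV k → ℝ} {α : ℝ} (hg : IsCircuit (CopiesE k) g) (hα : 0 < α)
    (hp : p ∈ dualPoly (CopiesE k) none c) (hpg : p + α • g ∈ dualPoly (CopiesE k) none c)
    (hmax : ∀ β : ℝ, α < β → p + β • g ∉ dualPoly (CopiesE k) none c) :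
    ∃ i, (∀ j, j ≠ i → ∀ x, (p + α • g) (copyNode j x) = p (copyNode j x)) ∧
      ∀ q : Fin 4 → ℤ, (∀ x, 9 * p (copyNode i x) = q x) →
        ∃ q' ∈ circuitSuccessors q, ∀ x, 9 * (p + α • g) (copyNode i x) = q' x := by
  rw [mem_dualPoly_copies_iff hc] at hp hpg
  simp only [mem_dualPoly_copies_iff hc] at hmax
  simp only [Pi.add_apply, Pi.smul_apply, smul_eq_mul] at hpg hmax ⊢
  have h0 : g none = 0 := by
    have := hpg.1
    rw [hp.1, zero_add] at this
    exact (mul_eq_zero.1 this).resolve_left hα.ne'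
  obtain ⟨i, hi, d, hd, hgd⟩ := exists_copy_of_isCircuit hg h0
  refine ⟨i, fun j hj x => by rw [hi j hj, mul_zero, add_zero], fun q hq => ?_⟩
  have htight : ∃ e ∈ exampleE, 0 < d e.2 - d e.1 ∧
      -(p (copyNode i e.1) + α * d e.1) + (p (copyNode i e.2) + α * d e.2) = exampleC e := by
    by_contra! hno
    have hev : ∀ e ∈ exampleE, ∀ᶠ β in nhdsWithin α (Set.Ioi α),
        -(p (copyNode i e.1) + β * d e.1) + (p (copyNode i e.2) + β * d e.2) ≤ exampleC e := by
      intro e he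
      have hle := hpg.2 i e he
      rw [hgd, hgd] at hle
      rcases lt_or_ge 0 (d e.2 - d e.1) with hpos | hneg
      · have hlt := lt_of_le_of_ne hle (hno e he hpos)
        have hcont : Continuous fun β : ℝ =>
            -(p (copyNode i e.1) + β * d e.1) + (p (copyNode i e.2) + β * d e.2) := by
          fun_prop
        filter_upwards [nhdsWithin_le_nhds (hcont.continuousAt.eventually_lt_const hlt)]
          with β hβ using hβ.le
      · filter_upwards [self_mem_nhdsWithin] with β hβ
        have hneg' : (d e.2 : ℝ) - d e.1 ≤ 0 := by exact_mod_cast hneg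
        have hβ' : α < β := hβ
        nlinarith
    have hall := (Filter.eventually_all_finite (Set.toFinite exampleE)).2 hev
    obtain ⟨β, hβ, hαβ⟩ := (hall.and self_mem_nhdsWithin).exists
    refine hmax β hαβ ⟨by rw [hp.1, h0, mul_zero, add_zero], fun j e he => ?_⟩
    by_cases hj : j = i
    · subst hj
      rw [hgd, hgd]
      exact hβ e he
    · rw [hi j hj, hi j hj, mul_zero, add_zero, add_zero]
      exact hp.2 j e he
  obtain ⟨e, he, hpos, heq⟩ := htight
  have hone : d e.2 - d e.1 = 1 := by
    have hdiff : ∀ d ∈ exampleDirections, ∀ x y, d x - d y ≤ 1 := by decide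
    have := hdiff d hd e.2 e.1
    omega
  have hone' : (d e.2 : ℝ) - d e.1 = 1 := by exact_mod_cast hone
  have hαs : 9 * α = scaledSlack q e := by
    rw [scaledSlack]
    push_cast
    rw [← nine_mul_exampleC he, ← hq, ← hq]
    linear_combination 9 * heq - 9 * α * hone'
  have hval : ∀ x, 9 * (p (copyNode i x) + α * g (copyNode i x)) =
      ((q x + scaledSlack q e * d x : ℤ) : ℝ) := by
    intro x
    push_cast
    rw [← hαs, ← hq, hgd]
    ring
  refine ⟨fun x => q x + scaledSlack q e * d x, ?_, hval⟩
  simp only [circuitSuccessors, List.mem_flatMap, List.mem_filter, List.mem_map,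
    List.all_eq_true, decide_eq_true_eq]
  refine ⟨d, hd, ⟨e, ⟨(mem_exampleE_iff e).1 he, hone⟩, rfl⟩, fun f hf => ?_⟩
  have hfE := (mem_exampleE_iff f).2 hf
  have hfeas := hpg.2 i f hfE
  have hreal : (0 : ℝ) ≤ (scaledSlack (fun x => q x + scaledSlack q e * d x) f : ℤ) := by
    rw [scaledSlack, Int.cast_sub, Int.cast_add, ← nine_mul_exampleC hfE, ← hval, ← hval]
    linarith
  exact_mod_cast hreal

/-- The points of a circuit walk starting at the origin restrict, on each copy, to points
reached by circuit steps in that copy, and the numbers of these steps add up to the number of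
steps made so far. -/
theorem exists_steps_of_isCircuitWalk
    (hc : ∀ (i : Fin k), ∀ e ∈ exampleE, c (copyNode i e.1, copyNode i e.2) = exampleC e)
    {n : ℕ} {w : Fin (n + 1) → CopiesV k → ℝ}
    (hw : IsCircuitWalk (CopiesE k) (dualPoly (CopiesE k) none c) w) (hw0 : w 0 = 0)
    (t : Fin (n + 1)) :
    ∃ m : Fin k → ℕ, ∑ i, m i = t ∧
      ∀ i, ∃ q ∈ circuitReach (m i), ∀ x, 9 * w t (copyNode i x) = q x := by
  induction t using Fin.induction with
  | zero => exact ⟨0, by simp, fun i => ⟨0, by simp [circuitReach], fun x => by simp [hw0]⟩⟩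
  | succ t ih =>
    obtain ⟨m, hm, hreach⟩ := ih
    obtain ⟨g, α, hg, hα, hsucc, hmax⟩ := hw.2 t
    obtain ⟨i, hother, hstep⟩ := exists_copy_of_circuit_step hc hg hα (hw.1 _)
      (hsucc ▸ hw.1 t.succ) hmax
    refine ⟨m + Pi.single i 1, ?_, fun j => ?_⟩
    · simp only [Pi.add_apply, Finset.sum_add_distrib, hm, Finset.sum_pi_single', Finset.mem_univ,
        if_true, Fin.val_castSucc, Fin.val_succ]
    · rw [hsucc]
      obtain ⟨q, hq, hwq⟩ := hreach j
      by_cases hj : j = i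
      · subst hj
        obtain ⟨q', hq', hwq'⟩ := hstep q hwq
        refine ⟨q', ?_, hwq'⟩
        simp only [Pi.add_apply, Pi.single_eq_same, circuitReach, List.mem_flatMap]
        exact ⟨q, hq, hq'⟩
      · refine ⟨q, by simpa [hj] using hq, fun x => ?_⟩
        rw [hother j hj, hwq]

/-- A point of the polyhedron of the glued graph is extreme if on each copy its tight edges
connect all nodes to `v₀`. -/
theorem mem_extremePoints_copies
    (hc : ∀ (i : Fin k), ∀ e ∈ exampleE, c (copyNode i e.1, copyNode i e.2) = exampleC e)
    {p : CopiesV k → ℝ} {q : Fin 4 → ℤ} (hq : ∀ i x, 9 * p (copyNode i x) = q x)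
    (hp0 : p none = 0) (hfeas : ∀ e ∈ exampleEdges, 0 ≤ scaledSlack q e)
    (hconn : ∀ x, ReflTransGen (UAdj {e | e ∈ exampleEdges ∧ scaledSlack q e = 0}) 0 x) :
    p ∈ (dualPoly (CopiesE k) none c).extremePoints ℝ := by
  have slack : ∀ (i : Fin k), ∀ e ∈ exampleE,
      9 * (exampleC e + p (copyNode i e.1) - p (copyNode i e.2)) = scaledSlack q e := by
    intro i e he
    rw [scaledSlack, Int.cast_sub, Int.cast_add, ← nine_mul_exampleC he, ← hq i, ← hq i]
    ring
  have hp : p ∈ dualPoly (CopiesE k) none c := by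
    refine (mem_dualPoly_copies_iff hc p).2 ⟨hp0, fun i e he => ?_⟩
    have h : (0 : ℝ) ≤ scaledSlack q e := by
      exact_mod_cast hfeas e ((mem_exampleE_iff e).1 he)
    rw [← slack i e he] at h
    linarith
  refine mem_extremePoints_dualPoly_of_tight hp ?_
  have lift : ∀ (i : Fin k) {a b}, (a, b) ∈ {e | e ∈ exampleEdges ∧ scaledSlack q e = 0} →
      (copyNode i a, copyNode i b) ∈ {e | e ∈ CopiesE k ∧ -p e.1 + p e.2 = c e} := by
    rintro i a b ⟨hab, htight⟩
    have habE := (mem_exampleE_iff _).2 hab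
    have h := slack i _ habE
    rw [htight, Int.cast_zero] at h
    refine ⟨(mem_copiesE_iff _).2 ⟨i, (a, b), habE, rfl⟩, ?_⟩
    rw [hc i (a, b) habE]
    dsimp only at h ⊢
    linarith
  rintro (_ | ⟨i, x, hx⟩)
  · exact .refl
  · rw [← copyNode_of_ne i hx, ← copyNode_zero i]
    exact (hconn x).lift (copyNode i) fun a b hab => hab.imp (lift i) (lift i)

theorem zero_mem_extremePoints
    (hc : ∀ (i : Fin k), ∀ e ∈ exampleE, c (copyNode i e.1, copyNode i e.2) = exampleC e) :
    0 ∈ (dualPoly (CopiesE k) none c).extremePoints ℝ := by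
  refine mem_extremePoints_copies hc (q := 0) (by simp) rfl (by decide) fun x => ?_
  have h3 : UAdj {e | e ∈ exampleEdges ∧ scaledSlack 0 e = 0} 0 3 := Or.inr (by decide)
  fin_cases x
  · exact .refl
  · exact .tail (.single h3) (Or.inl (by decide))
  · exact .single (Or.inr (by decide))
  · exact .single h3

/-- The point of the polyhedron of the glued graph with coordinates `0, 2/3, 4/3, 2` on each
copy. -/
noncomputable def copiesTarget (k : ℕ) : CopiesV k → ℝ
  | none => 0
  | some a => ((![0, 6, 12, 18] : Fin 4 → ℤ) a.2.1 : ℝ) / 9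

theorem nine_mul_copiesTarget (i : Fin k) (x : Fin 4) :
    9 * copiesTarget k (copyNode i x) = (![0, 6, 12, 18] : Fin 4 → ℤ) x := by
  by_cases hx : x = 0
  · subst hx
    simp [copyNode_zero, copiesTarget]
  · rw [copyNode_of_ne i hx, copiesTarget]
    ring

theorem copiesTarget_mem_extremePoints
    (hc : ∀ (i : Fin k), ∀ e ∈ exampleE, c (copyNode i e.1, copyNode i e.2) = exampleC e) :
    copiesTarget k ∈ (dualPoly (CopiesE k) none c).extremePoints ℝ := by
  refine mem_extremePoints_copies hc nine_mul_copiesTarget rfl (by decide) fun x => ?_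
  have h3 : UAdj {e | e ∈ exampleEdges ∧ scaledSlack ![0, 6, 12, 18] e = 0} 0 3 :=
    Or.inl (by decide)
  fin_cases x
  · exact .refl
  · exact .tail (.single h3) (Or.inr (by decide))
  · exact .single (Or.inl (by decide))
  · exact .single h3

end Copies

/-- **Glueing `k` copies of Example 1.**
For every `k ≥ 1`, the graph `G` obtained by glueing `k` disjoint copies of `G₄` together at
their distinguished nodes (with the inherited costs `c`) has `3k + 1` nodes, and the circuit
diameter of `P(G,c)` is at least `4k`: there are two extreme points of `P(G,c)` such that
every circuit walk from one to the other has length at least `4k`. -/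
theorem glued_copies_circuit_diameter (k : ℕ) (hk : 1 ≤ k)
    (c : GluedV (fun _ : Fin k => Fin 4) (fun _ => 0) ×
      GluedV (fun _ : Fin k => Fin 4) (fun _ => 0) → ℝ)
    (hc : ∀ (i : Fin k), ∀ e ∈ exampleE,
      c (glueMap (fun _ : Fin k => (0 : Fin 4)) i e.1,
        glueMap (fun _ : Fin k => (0 : Fin 4)) i e.2) = exampleC e) :
    Fintype.card (GluedV (fun _ : Fin k => Fin 4) (fun _ => 0)) = 3 * k + 1 ∧
    ∃ u ∈ (dualPoly (GluedE (fun _ : Fin k => exampleE) (fun _ => 0))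
        (none : GluedV (fun _ : Fin k => Fin 4) (fun _ => 0)) c).extremePoints ℝ,
      ∃ v ∈ (dualPoly (GluedE (fun _ : Fin k => exampleE) (fun _ => 0))
          (none : GluedV (fun _ : Fin k => Fin 4) (fun _ => 0)) c).extremePoints ℝ,
        ∀ (n : ℕ) (w : Fin (n + 1) → GluedV (fun _ : Fin k => Fin 4) (fun _ => 0) → ℝ),
          IsCircuitWalk (GluedE (fun _ : Fin k => exampleE) (fun _ => 0))
              (dualPoly (GluedE (fun _ : Fin k => exampleE) (fun _ => 0))
                (none : GluedV (fun _ : Fin k => Fin 4) (fun _ => 0)) c) w →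
            w 0 = u → w (Fin.last n) = v → 4 * k ≤ n := by
  refine ⟨by simp [mul_comm], 0, zero_mem_extremePoints hc, copiesTarget k,
    copiesTarget_mem_extremePoints hc, fun n w hw hw0 hwn => ?_⟩
  obtain ⟨m, hm, hreach⟩ := exists_steps_of_isCircuitWalk hc hw hw0 (Fin.last n)
  have hfour : ∀ i, 4 ≤ m i := by
    intro i
    obtain ⟨q, hq, hwq⟩ := hreach i
    by_contra! hlt
    have hq' : q = ![0, 6, 12, 18] := by
      funext x
      rw [← Int.cast_inj (α := ℝ), ← hwq, hwn, nine_mul_copiesTarget]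
    exact target_notMem_circuitReach _ hlt (hq' ▸ hq)
  calc 4 * k = ∑ _i : Fin k, 4 := by simp [mul_comm]
    _ ≤ ∑ i, m i := Finset.sum_le_sum fun i _ => hfour i
    _ = n := by rw [hm, Fin.val_last]
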